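/- arXiv:2007.06088 — 2 statements merged into one kernel-verified Lean document; each statement's English description precedes it below -/
import Mathlib

section
/- For every ε ∈ I with |ε| ≤ ε₀, every ω ∈ Ω' and every n ∈ ℕ, ‖L_{σ^{−n}ω,ε}ⁿ h_{σ^{−n}ω}^ε − L_{σ^{−n}ω}ⁿ h_{σ^{−n}ω}^ε‖_w ≤ 2 n C³ |ε| · M, where M := sup_{|ε'|≤ε₀} sup_{ω'∈Ω'} ‖h_{ω'}^{ε'}‖_s. -/
open MeasureTheory Filter Topology

noncomputable section

/-- The cocycle of operators:
`iterOp σ L ε n ω = L (σ^[n-1] ω) ε ∘ ⋯ ∘ L (σ ω) ε ∘ L ω ε`. -/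
def iterOp {Ω B : Type*} [NormedAddCommGroup B] [NormedSpace ℝ B]
    (σ : Ω → Ω) (L : Ω → ℝ → (B →L[ℝ] B)) (ε : ℝ) : ℕ → Ω → (B →L[ℝ] B)
  | 0, _ => ContinuousLinearMap.id ℝ B
  | n + 1, ω => iterOp σ L ε n (σ ω) ∘L L ω ε

theorem stmt_6
    {Ω : Type*} [MeasurableSpace Ω] (P : Measure Ω) [IsProbabilityMeasure P]
    (σ σinv : Ω → Ω)
    (hσinv₁ : Function.LeftInverse σinv σ) (hσinv₂ : Function.RightInverse σinv σ)
    (hσinvmeas : Measurable σinv)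
    (hσerg : Ergodic σ P)
    {Bs Bw : Type*}
    [NormedAddCommGroup Bs] [NormedSpace ℝ Bs] [CompleteSpace Bs]
    [NormedAddCommGroup Bw] [NormedSpace ℝ Bw] [CompleteSpace Bw]
    [MeasurableSpace Bs] [BorelSpace Bs]
    (ιw : Bs →ₗ[ℝ] Bw) (hιw_inj : Function.Injective ιw)
    (hιw_norm : ∀ h : Bs, ‖ιw h‖ ≤ ‖h‖)
    (ψ : Bw →L[ℝ] ℝ) (hψ_ne : ∃ g : Bs, ψ (ιw g) ≠ 0)
    (I : Set ℝ) (hI : I ∈ nhds (0 : ℝ))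
    (L : Ω → ℝ → (Bs →L[ℝ] Bs)) (Lw : Ω → ℝ → (Bw →L[ℝ] Bw))
    (hcompat : ∀ (ω : Ω) (ε : ℝ) (h : Bs), ιw (L ω ε h) = Lw ω ε (ιw h))
    (hmeas : ∀ ε ∈ I, ∀ h : Bs, Measurable fun ω => L ω ε h)
    (D lam C lam1 : ℝ) (hD : 0 < D) (hlam : 0 < lam) (hC : 0 < C)
    (hlam1 : lam1 ∈ Set.Ioo (0 : ℝ) 1)
    (Ω' : Set Ω) (hΩ'meas : MeasurableSet Ω') (hΩ'full : P Ω' = 1)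
    (hΩ'inv : ∀ ω, ω ∈ Ω' ↔ σ ω ∈ Ω')
    (hdec : ∀ ω ∈ Ω', ∀ n : ℕ, ∀ h : Bs, ψ (ιw h) = 0 →
      ‖iterOp σ L 0 n ω h‖ ≤ D * Real.exp (-lam * n) * ‖h‖)
    (h1 : ∀ ε ∈ I, ∀ ω ∈ Ω', ∀ n : ℕ, ∀ h : Bs,
      ‖iterOp σ L ε n ω h‖ ≤ C * lam1 ^ n * ‖h‖ + C * ‖ιw h‖)
    (h2 : ∀ ε ∈ I, ∀ ω ∈ Ω', ∀ h : Bs,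
      ‖ιw (L ω ε h) - ιw (L ω 0 h)‖ ≤ C * |ε| * ‖h‖)
    (h3 : ∀ ε ∈ I, ∀ ω ∈ Ω', ∀ n : ℕ, ‖iterOp σ Lw ε n ω‖ ≤ C)
    (h4 : ∀ ε ∈ I, ∀ ω ∈ Ω', ∀ h : Bs, ψ (ιw (L ω ε h)) = ψ (ιw h))
    (ε₀ D' lam' : ℝ) (hε₀ : 0 < ε₀) (hD' : 0 < D') (hlam' : 0 < lam')
    (hdec' : ∀ ε ∈ I, |ε| ≤ ε₀ → ∀ ω ∈ Ω', ∀ n : ℕ, ∀ h : Bs, ψ (ιw h) = 0 →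
      ‖iterOp σ L ε n ω h‖ ≤ D' * Real.exp (-lam' * n) * ‖h‖)
    (hfun : ℝ → Ω → Bs)
    (hfam : ∀ ε ∈ I, |ε| ≤ ε₀ →
      Measurable (hfun ε) ∧ (∃ M : ℝ, ∀ ω ∈ Ω', ‖hfun ε ω‖ ≤ M) ∧
      (∀ ω ∈ Ω', ψ (ιw (hfun ε ω)) = 1) ∧
      (∀ ω ∈ Ω', L ω ε (hfun ε ω) = hfun ε (σ ω)))
    :
    ∀ ε ∈ I, |ε| ≤ ε₀ → ∀ ω ∈ Ω', ∀ n : ℕ, ∀ M : ℝ,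
      (∀ ε' ∈ I, |ε'| ≤ ε₀ → ∀ ω' ∈ Ω', ‖hfun ε' ω'‖ ≤ M) →
      ‖ιw (iterOp σ L ε n (σinv^[n] ω) (hfun ε (σinv^[n] ω))) -
        ιw (iterOp σ L 0 n (σinv^[n] ω) (hfun ε (σinv^[n] ω)))‖ ≤
        2 * n * C ^ 3 * |ε| * M := by
  intro ε hε hεε ω hω n M hM
  have h0I : (0 : ℝ) ∈ I := mem_of_mem_nhds hI
  have hinv : ∀ k : ℕ, σinv^[k] ω ∈ Ω' := by
    intro k
    induction k with
    | zero => exact hω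
    | succ k ih =>
      rw [Function.iterate_succ_apply', hΩ'inv, hσinv₂]
      exact ih
  have hM0 : 0 ≤ M := (norm_nonneg _).trans (hM ε hε hεε ω hω)
  have hC1 : 1 ≤ C := by
    obtain ⟨g, hg⟩ := hψ_ne
    have hg0 : ιw g ≠ 0 := fun h => hg (by rw [h, map_zero])
    have : Nontrivial Bw := ⟨⟨_, _, hg0⟩⟩
    have h := h3 0 h0I ω hω 0
    simp only [iterOp] at h
    rwa [ContinuousLinearMap.norm_id] at h
  have hcomp : ∀ (n : ℕ) (ω : Ω) (h : Bs),
      ιw (iterOp σ L 0 n ω h) = iterOp σ Lw 0 n ω (ιw h) := by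
    intro n
    induction n with
    | zero => intro ω h; simp [iterOp]
    | succ n ih => intro ω h; simp [iterOp, ih, hcompat]
  have key : ∀ (n : ℕ), ∀ ω ∈ Ω',
      ‖ιw (iterOp σ L ε n ω (hfun ε ω)) - ιw (iterOp σ L 0 n ω (hfun ε ω))‖
        ≤ n * (C * (C * |ε| * M)) := by
    intro n
    induction n with
    | zero => intro ω hω; simp [iterOp]
    | succ n ih =>
      intro ω hω
      have hσω := (hΩ'inv ω).1 hω
      have e := (hfam ε hε hεε).2.2.2 ω hω
      have a := ih (σ ω) hσω
      have b : ‖iterOp σ Lw 0 n (σ ω) (ιw (L ω ε (hfun ε ω)) - ιw (L ω 0 (hfun ε ω)))‖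
          ≤ C * (C * |ε| * M) := by
        refine (ContinuousLinearMap.le_opNorm _ _).trans ?_
        refine mul_le_mul (h3 0 h0I _ hσω n) ((h2 ε hε ω hω _).trans ?_) (norm_nonneg _) hC.le
        exact mul_le_mul_of_nonneg_left (hM ε hε hεε ω hω) (by positivity)
      have c : ιw (iterOp σ L ε (n + 1) ω (hfun ε ω)) - ιw (iterOp σ L 0 (n + 1) ω (hfun ε ω))
          = (ιw (iterOp σ L ε n (σ ω) (hfun ε (σ ω)))
              - ιw (iterOp σ L 0 n (σ ω) (hfun ε (σ ω))))
            + iterOp σ Lw 0 n (σ ω) (ιw (L ω ε (hfun ε ω)) - ιw (L ω 0 (hfun ε ω))) := by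
        rw [map_sub, ← hcomp, ← hcomp, ← e]
        simp only [iterOp, ContinuousLinearMap.comp_apply]
        abel
      rw [c]
      refine (norm_add_le _ _).trans ?_
      push_cast
      linarith
  refine (key n _ (hinv n)).trans ?_
  have hX : 0 ≤ n * C ^ 2 * |ε| * M := by positivity
  nlinarith [mul_nonneg hX (by linarith : (0 : ℝ) ≤ 2 * C - 1)]
end
end

section
/- Lemma 3.5: There exist ε₀, D' > 0 and λ' > 0 such that for every ε ∈ I with |ε| ≤ ε₀, every ω ∈ Ω' and every n ∈ ℕ: ‖L_{ω,ε}ⁿ h‖_ss ≤ D' e^{−λ'n} ‖h‖_ss for all h ∈ B_ss⁰, and ‖L_{ω,ε}ⁿ h‖_s ≤ D' e^{−λ'n} ‖h‖_s for all h ∈ B_s⁰. -/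
open MeasureTheory Filter Topology

noncomputable section

theorem iterOp_add_aux {Ω B : Type*} [NormedAddCommGroup B] [NormedSpace ℝ B]
    (σ : Ω → Ω) (L : Ω → ℝ → (B →L[ℝ] B)) (ε : ℝ) (m k : ℕ) :
    ∀ (ω : Ω) (h : B), iterOp σ L ε (m + k) ω h
      = iterOp σ L ε k (σ^[m] ω) (iterOp σ L ε m ω h) := by
  induction m with
  | zero => intro ω h; simp [iterOp]
  | succ m ih =>
    intro ω h
    have : m + 1 + k = (m + k) + 1 := by omega
    rw [this]
    simp only [iterOp, ContinuousLinearMap.comp_apply, Function.iterate_succ, Function.comp]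
    exact ih _ _

theorem decay_aux {Ω E F : Type*} [NormedAddCommGroup E] [NormedSpace ℝ E]
    [NormedAddCommGroup F] [NormedSpace ℝ F] (σ : Ω → Ω)
    (ι : E →ₗ[ℝ] F) (hι : ∀ h, ‖ι h‖ ≤ ‖h‖) (φ : E → ℝ) (I : Set ℝ) (h0 : (0 : ℝ) ∈ I)
    (A : Ω → ℝ → (E →L[ℝ] E)) (Aw : Ω → ℝ → (F →L[ℝ] F))
    (hcompat : ∀ (ω : Ω) (ε : ℝ) (h : E), ι (A ω ε h) = Aw ω ε (ι h))
    (D lam C lam1 K : ℝ) (hD : 0 < D) (hlam : 0 < lam) (hC : 0 < C) (hK : 0 < K)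
    (hlam1 : lam1 ∈ Set.Ioo (0 : ℝ) 1)
    (Ω' : Set Ω) (hinv : ∀ ω ∈ Ω', σ ω ∈ Ω')
    (hdec : ∀ ω ∈ Ω', ∀ n : ℕ, ∀ h : E, φ h = 0 →
      ‖iterOp σ A 0 n ω h‖ ≤ D * Real.exp (-lam * n) * ‖h‖)
    (h1 : ∀ ε ∈ I, ∀ ω ∈ Ω', ∀ n : ℕ, ∀ h : E,
      ‖iterOp σ A ε n ω h‖ ≤ C * lam1 ^ n * ‖h‖ + C * ‖ι h‖)
    (h2 : ∀ ε ∈ I, ∀ ω ∈ Ω', ∀ h : E, ‖ι (A ω ε h) - ι (A ω 0 h)‖ ≤ C * |ε| * ‖h‖)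
    (h3 : ∀ ω ∈ Ω', ∀ n : ℕ, ∀ g : F, ‖iterOp σ Aw 0 n ω g‖ ≤ K * ‖g‖)
    (h4 : ∀ ε ∈ I, ∀ ω ∈ Ω', ∀ h : E, φ (A ω ε h) = φ h) :
    ∃ ε₀ > (0 : ℝ), ∃ D' > (0 : ℝ), ∃ lam' > (0 : ℝ),
      ∀ ε ∈ I, |ε| ≤ ε₀ → ∀ ω ∈ Ω', ∀ n : ℕ, ∀ h : E, φ h = 0 →
          ‖iterOp σ A ε n ω h‖ ≤ D' * Real.exp (-lam' * n) * ‖h‖ := by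
  obtain ⟨hl0, hl1⟩ := hlam1
  have hinvn : ∀ m : ℕ, ∀ ω ∈ Ω', σ^[m] ω ∈ Ω' := by
    intro m
    induction m with
    | zero => intro ω h; simpa using h
    | succ m ih => intro ω h; exact ih _ (hinv ω h)
  have hcn : ∀ (ε : ℝ) (n : ℕ) (ω : Ω) (h : E),
      ι (iterOp σ A ε n ω h) = iterOp σ Aw ε n ω (ι h) := by
    intro ε n
    induction n with
    | zero => intro ω h; simp [iterOp]
    | succ n ih => intro ω h; simp [iterOp, ih, hcompat]
  have hφn : ∀ ε ∈ I, ∀ n : ℕ, ∀ ω ∈ Ω', ∀ h : E, φ (iterOp σ A ε n ω h) = φ h := by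
    intro ε hε n
    induction n with
    | zero => intro ω _ h; simp [iterOp]
    | succ n ih =>
      intro ω hω h
      simp only [iterOp, ContinuousLinearMap.comp_apply]
      rw [ih _ (hinv ω hω), h4 ε hε ω hω]
  have hbd : ∀ ε ∈ I, ∀ ω ∈ Ω', ∀ n : ℕ, ∀ h : E, ‖iterOp σ A ε n ω h‖ ≤ 2 * C * ‖h‖ := by
    intro ε hε ω hω n h
    have a := h1 ε hε ω hω n h
    have b : lam1 ^ n ≤ 1 := pow_le_one₀ hl0.le hl1.le
    have c : C * lam1 ^ n * ‖h‖ ≤ C * 1 * ‖h‖ := by gcongr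
    have d : C * ‖ι h‖ ≤ C * ‖h‖ := by gcongr; exact hι h
    linarith
  have hdiff : ∀ n : ℕ, ∃ c : ℝ, 0 ≤ c ∧ ∀ ε ∈ I, ∀ ω ∈ Ω', ∀ h : E,
      ‖ι (iterOp σ A ε n ω h) - ι (iterOp σ A 0 n ω h)‖ ≤ c * |ε| * ‖h‖ := by
    intro n
    induction n with
    | zero => exact ⟨0, le_rfl, by intro ε _ ω _ h; simp [iterOp]⟩
    | succ n ih =>
      obtain ⟨c, hc, H⟩ := ih
      refine ⟨c * (2 * C) + K * C, by positivity, ?_⟩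
      intro ε hε ω hω h
      simp only [iterOp, ContinuousLinearMap.comp_apply]
      have a := H ε hε (σ ω) (hinv ω hω) (A ω ε h)
      have b := hbd ε hε ω hω 1 h
      simp only [iterOp, ContinuousLinearMap.comp_apply, ContinuousLinearMap.id_apply] at b
      have d : ‖ι (iterOp σ A 0 n (σ ω) (A ω ε h)) - ι (iterOp σ A 0 n (σ ω) (A ω 0 h))‖
          ≤ K * (C * |ε| * ‖h‖) := by
        rw [hcn, hcn, ← map_sub]
        refine (h3 _ (hinv ω hω) n _).trans ?_
        gcongr
        exact h2 ε hε ω hω h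
      have e : c * |ε| * ‖A ω ε h‖ ≤ c * |ε| * (2 * C * ‖h‖) := by gcongr
      have f := norm_sub_le_norm_sub_add_norm_sub (ι (iterOp σ A ε n (σ ω) (A ω ε h)))
        (ι (iterOp σ A 0 n (σ ω) (A ω ε h))) (ι (iterOp σ A 0 n (σ ω) (A ω 0 h)))
      calc _ ≤ _ := f
        _ ≤ c * |ε| * (2 * C * ‖h‖) + K * (C * |ε| * ‖h‖) := add_le_add (a.trans e) d
        _ = _ := by ring
  -- choose N
  have hlim : Tendsto (fun n : ℕ => C * lam1 ^ n * (2 * C) + C * (D * Real.exp (-lam * n)))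
      atTop (𝓝 0) := by
    have t1 : Tendsto (fun n : ℕ => lam1 ^ n) atTop (𝓝 0) :=
      tendsto_pow_atTop_nhds_zero_of_lt_one hl0.le hl1
    have t2 : Tendsto (fun n : ℕ => Real.exp (-lam * n)) atTop (𝓝 0) := by
      have : Tendsto (fun n : ℕ => (Real.exp (-lam)) ^ n) atTop (𝓝 0) :=
        tendsto_pow_atTop_nhds_zero_of_lt_one (Real.exp_pos _).le
          (Real.exp_lt_one_iff.mpr (by linarith))
      refine this.congr (fun n => ?_)
      rw [← Real.exp_nat_mul]; ring_nf
    have := ((t1.const_mul C).mul_const (2 * C)).add ((t2.const_mul D).const_mul C)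
    simpa using this
  obtain ⟨N, hN, hN1⟩ :=
    ((hlim.eventually (gt_mem_nhds (show (0 : ℝ) < 1 / 4 by norm_num))).and
      (eventually_ge_atTop 1)).exists
  obtain ⟨c, hc, H⟩ := hdiff N
  have hhalf : ∀ ε ∈ I, |ε| ≤ 1 / (4 * C * (c + 1)) → ∀ ω ∈ Ω', ∀ h : E, φ h = 0 →
      ‖iterOp σ A ε (N + N) ω h‖ ≤ 1 / 2 * ‖h‖ := by
    intro ε hε hεs ω hω h hh
    rw [iterOp_add_aux]
    have a := h1 ε hε _ (hinvn N ω hω) N (iterOp σ A ε N ω h)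
    have b := hbd ε hε ω hω N h
    have d := H ε hε ω hω h
    have e := hdec ω hω N h hh
    have f := hι (iterOp σ A 0 N ω h)
    have g : ‖ι (iterOp σ A ε N ω h)‖ ≤ c * |ε| * ‖h‖ + D * Real.exp (-lam * N) * ‖h‖ := by
      have := norm_le_norm_sub_add (ι (iterOp σ A ε N ω h)) (ι (iterOp σ A 0 N ω h))
      linarith
    have hs : C * (c * |ε|) ≤ 1 / 4 := by
      rw [le_div_iff₀ (by positivity)] at hεs
      have : 0 ≤ C * |ε| := by positivity
      nlinarith
    calc _ ≤ _ := a
      _ ≤ C * lam1 ^ N * (2 * C * ‖h‖)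
          + C * (c * |ε| * ‖h‖ + D * Real.exp (-lam * N) * ‖h‖) := by gcongr
      _ = ((C * lam1 ^ N * (2 * C) + C * (D * Real.exp (-lam * N))) + C * (c * |ε|)) * ‖h‖ := by
          ring
      _ ≤ 1 / 2 * ‖h‖ := by gcongr; linarith
  have hmpos : (0 : ℝ) < ((N + N : ℕ) : ℝ) := by
    have : 0 < N + N := by omega
    exact_mod_cast this
  generalize N + N = m at hhalf hmpos
  have hlog : 0 < Real.log 2 := Real.log_pos (by norm_num)
  refine ⟨1 / (4 * C * (c + 1)), by positivity, 4 * C, by positivity, Real.log 2 / m,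
    by positivity, ?_⟩
  intro ε hε hεs ω hω n
  induction n using Nat.strong_induction_on generalizing ω with
  | _ n ih =>
    intro h hh
    rcases lt_or_ge n m with hnm | hnm
    · have a := hbd ε hε ω hω n h
      have b : (1 : ℝ) / 2 ≤ Real.exp (-(Real.log 2 / m) * n) := by
        have : (1 : ℝ) / 2 = Real.exp (-Real.log 2) := by
          rw [Real.exp_neg, Real.exp_log (by norm_num)]; norm_num
        rw [this]
        apply Real.exp_le_exp.mpr
        have hn : (n : ℝ) ≤ m := by exact_mod_cast hnm.le
        have : Real.log 2 / m * n ≤ Real.log 2 / m * m := by gcongr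
        rw [div_mul_cancel₀ _ hmpos.ne'] at this
        linarith
      calc _ ≤ _ := a
        _ = 4 * C * (1 / 2) * ‖h‖ := by ring
        _ ≤ _ := by gcongr
    · obtain ⟨k, rfl⟩ := Nat.exists_eq_add_of_le hnm
      have hm0 : 0 < m := by exact_mod_cast hmpos
      rw [iterOp_add_aux]
      have a := ih k (by omega) _ (hinvn m ω hω) (iterOp σ A ε m ω h)
        (by rw [hφn ε hε m ω hω, hh])
      have b := hhalf ε hε hεs ω hω h hh
      have e : Real.exp (-(Real.log 2 / m) * ((m + k : ℕ) : ℝ))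
          = 1 / 2 * Real.exp (-(Real.log 2 / m) * k) := by
        have : -(Real.log 2 / m) * ((m + k : ℕ) : ℝ)
            = -Real.log 2 + -(Real.log 2 / m) * k := by
          push_cast; field_simp; ring
        rw [this, Real.exp_add, Real.exp_neg, Real.exp_log (by norm_num)]; norm_num
      rw [e]
      calc _ ≤ _ := a
        _ ≤ 4 * C * Real.exp (-(Real.log 2 / m) * k) * (1 / 2 * ‖h‖) := by gcongr
        _ = _ := by ring

theorem stmt_9
    {Ω : Type*} [MeasurableSpace Ω] (P : Measure Ω) [IsProbabilityMeasure P]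
    (σ σinv : Ω → Ω)
    (hσinv₁ : Function.LeftInverse σinv σ) (hσinv₂ : Function.RightInverse σinv σ)
    (hσinvmeas : Measurable σinv)
    (hσerg : Ergodic σ P)
    {Bs Bw : Type*}
    [NormedAddCommGroup Bs] [NormedSpace ℝ Bs] [CompleteSpace Bs]
    [NormedAddCommGroup Bw] [NormedSpace ℝ Bw] [CompleteSpace Bw]
    [MeasurableSpace Bs] [BorelSpace Bs]
    (ιw : Bs →ₗ[ℝ] Bw) (hιw_inj : Function.Injective ιw)
    (hιw_norm : ∀ h : Bs, ‖ιw h‖ ≤ ‖h‖)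
    (ψ : Bw →L[ℝ] ℝ) (hψ_ne : ∃ g : Bs, ψ (ιw g) ≠ 0)
    (I : Set ℝ) (hI : I ∈ nhds (0 : ℝ))
    (L : Ω → ℝ → (Bs →L[ℝ] Bs)) (Lw : Ω → ℝ → (Bw →L[ℝ] Bw))
    (hcompat : ∀ (ω : Ω) (ε : ℝ) (h : Bs), ιw (L ω ε h) = Lw ω ε (ιw h))
    (hmeas : ∀ ε ∈ I, ∀ h : Bs, Measurable fun ω => L ω ε h)
    (D lam C lam1 : ℝ) (hD : 0 < D) (hlam : 0 < lam) (hC : 0 < C)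
    (hlam1 : lam1 ∈ Set.Ioo (0 : ℝ) 1)
    (Ω' : Set Ω) (hΩ'meas : MeasurableSet Ω') (hΩ'full : P Ω' = 1)
    (hΩ'inv : ∀ ω, ω ∈ Ω' ↔ σ ω ∈ Ω')
    (hdec : ∀ ω ∈ Ω', ∀ n : ℕ, ∀ h : Bs, ψ (ιw h) = 0 →
      ‖iterOp σ L 0 n ω h‖ ≤ D * Real.exp (-lam * n) * ‖h‖)
    (h1 : ∀ ε ∈ I, ∀ ω ∈ Ω', ∀ n : ℕ, ∀ h : Bs,
      ‖iterOp σ L ε n ω h‖ ≤ C * lam1 ^ n * ‖h‖ + C * ‖ιw h‖)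
    (h2 : ∀ ε ∈ I, ∀ ω ∈ Ω', ∀ h : Bs,
      ‖ιw (L ω ε h) - ιw (L ω 0 h)‖ ≤ C * |ε| * ‖h‖)
    (h3 : ∀ ε ∈ I, ∀ ω ∈ Ω', ∀ n : ℕ, ‖iterOp σ Lw ε n ω‖ ≤ C)
    (h4 : ∀ ε ∈ I, ∀ ω ∈ Ω', ∀ h : Bs, ψ (ιw (L ω ε h)) = ψ (ιw h))
    {Bss : Type*} [NormedAddCommGroup Bss] [NormedSpace ℝ Bss] [CompleteSpace Bss]
    [MeasurableSpace Bss] [BorelSpace Bss]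
    (ιs : Bss →ₗ[ℝ] Bs) (hιs_inj : Function.Injective ιs)
    (hιs_norm : ∀ h : Bss, ‖ιs h‖ ≤ ‖h‖)
    (Lss : Ω → ℝ → (Bss →L[ℝ] Bss))
    (hcompat_ss : ∀ (ω : Ω) (ε : ℝ) (h : Bss), ιs (Lss ω ε h) = L ω ε (ιs h))
    (hmeas_ss : ∀ ε ∈ I, ∀ h : Bss, Measurable fun ω => Lss ω ε h)
    (h1011 : ∀ ω ∈ Ω', ∀ n : ℕ, ∀ h : Bss, ψ (ιw (ιs h)) = 0 →
      ‖iterOp σ Lss 0 n ω h‖ ≤ D * Real.exp (-lam * n) * ‖h‖)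
    (h1x : ∀ ε ∈ I, ∀ ω ∈ Ω', ∀ n : ℕ, ∀ h : Bss,
      ‖iterOp σ Lss ε n ω h‖ ≤ C * lam1 ^ n * ‖h‖ + C * ‖ιs h‖)
    (h2x : ∀ ε ∈ I, ∀ ω ∈ Ω', ∀ h : Bss,
      ‖L ω ε (ιs h) - L ω 0 (ιs h)‖ ≤ C * |ε| * ‖h‖)
    :
    ∃ ε₀ > (0 : ℝ), ∃ D' > (0 : ℝ), ∃ lam' > (0 : ℝ),
      ∀ ε ∈ I, |ε| ≤ ε₀ → ∀ ω ∈ Ω', ∀ n : ℕ,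
        (∀ h : Bss, ψ (ιw (ιs h)) = 0 →
          ‖iterOp σ Lss ε n ω h‖ ≤ D' * Real.exp (-lam' * n) * ‖h‖) ∧
        (∀ h : Bs, ψ (ιw h) = 0 →
          ‖iterOp σ L ε n ω h‖ ≤ D' * Real.exp (-lam' * n) * ‖h‖) := by
  have h0 : (0 : ℝ) ∈ I := mem_of_mem_nhds hI
  have hinv : ∀ ω ∈ Ω', σ ω ∈ Ω' := fun ω h => (hΩ'inv ω).1 h
  obtain ⟨e1, he1, D1, hD1, l1, hl1, H1⟩ := decay_aux σ ιw hιw_norm (fun h => ψ (ιw h)) I h0 L Lw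
    hcompat D lam C lam1 C hD hlam hC hC hlam1 Ω' hinv hdec h1 h2
    (fun ω hω n g => (iterOp σ Lw 0 n ω).le_of_opNorm_le (h3 0 h0 ω hω n) g) h4
  obtain ⟨e2, he2, D2, hD2, l2, hl2, H2⟩ := decay_aux σ ιs hιs_norm
    (fun h => ψ (ιw (ιs h))) I h0 Lss L
    hcompat_ss D lam C lam1 (2 * C) hD hlam hC (by positivity) hlam1 Ω' hinv h1011 h1x
    (fun ε hε ω hω h => by rw [hcompat_ss, hcompat_ss]; exact h2x ε hε ω hω h)
    (fun ω hω n g => by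
      have a := h1 0 h0 ω hω n g
      have b : lam1 ^ n ≤ 1 := pow_le_one₀ hlam1.1.le hlam1.2.le
      have c : C * lam1 ^ n * ‖g‖ ≤ C * 1 * ‖g‖ := by gcongr
      have d : C * ‖ιw g‖ ≤ C * ‖g‖ := by gcongr; exact hιw_norm g
      linarith)
    (fun ε hε ω hω h => by
      show ψ (ιw (ιs (Lss ω ε h))) = ψ (ιw (ιs h))
      rw [hcompat_ss]; exact h4 ε hε ω hω _)
  refine ⟨min e1 e2, lt_min he1 he2, max D1 D2, lt_max_of_lt_left hD1, min l1 l2,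
    lt_min hl1 hl2, ?_⟩
  intro ε hε hεs ω hω n
  refine ⟨fun h hh => ?_, fun h hh => ?_⟩
  · refine (H2 ε hε (hεs.trans (min_le_right _ _)) ω hω n h hh).trans ?_
    gcongr
    · exact le_max_right _ _
    · exact min_le_right _ _
  · refine (H1 ε hε (hεs.trans (min_le_left _ _)) ω hω n h hh).trans ?_
    gcongr
    · exact le_max_left _ _
    · exact min_le_left _ _
end
end
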